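/- Let q > 0 and let ψ : ℝ → ℝ be (say, continuous and compactly supported). Then the supremum of ∫_{-∞}^{∞} ψ(y) f(y) dy over compactly supported smooth real f with ∫_{-∞}^{∞} (f'(y)² + q² f(y)²) dy ≤ 1 equals the square root of ∫_{-∞}^{∞} |∫_s^{∞} ψ(y) e^{q(s-y)} dy|² ds. -/

import Mathlib

open MeasureTheory

lemma aux_deriv (q : ℝ) (ψ : ℝ → ℝ) (hψc : Continuous ψ) (hψs : HasCompactSupport ψ) (s : ℝ) :
    HasDerivAt (fun s => ∫ y in Set.Ioi s, ψ y * Real.exp (q * (s - y)))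
      (q * (∫ y in Set.Ioi s, ψ y * Real.exp (q * (s - y))) - ψ s) s := by
  have hInt : Integrable (fun y => ψ y * Real.exp (-(q * y))) :=
    Continuous.integrable_of_hasCompactSupport (by fun_prop) hψs.mul_right
  have key : ∀ s, (∫ y in Set.Ioi s, ψ y * Real.exp (q * (s - y))) =
      Real.exp (q * s) * ((∫ y in Set.Ioi 0, ψ y * Real.exp (-(q * y)))
        - ∫ y in (0:ℝ)..s, ψ y * Real.exp (-(q * y))) := by
    intro s
    rw [← intervalIntegral.integral_Ioi_sub_Ioi' hInt.integrableOn hInt.integrableOn,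
      sub_sub_cancel, ← integral_const_mul]
    congr 1; ext y
    rw [mul_sub, sub_eq_add_neg, Real.exp_add]; ring
  have hF : HasDerivAt (fun s => ∫ y in (0:ℝ)..s, ψ y * Real.exp (-(q * y)))
      (ψ s * Real.exp (-(q * s))) s :=
    Continuous.deriv_integral (f := fun y => ψ y * Real.exp (-(q * y))) (by fun_prop) 0 s ▸
      (intervalIntegral.integral_hasDerivAt_right (hInt.intervalIntegrable)
        (Continuous.stronglyMeasurableAtFilter (by fun_prop) _ _) (by fun_prop)).differentiableAt.hasDerivAt
  have he : HasDerivAt (fun s => Real.exp (q * s)) (Real.exp (q * s) * q) s := by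
    simpa using ((hasDerivAt_id s).const_mul q).exp
  rw [key s]
  rw [funext key]
  refine HasDerivAt.congr_deriv (he.mul (hF.const_sub _)) ?_
  have : Real.exp (q * s) * Real.exp (-(q * s)) = 1 := by rw [← Real.exp_add]; simp
  linear_combination (-ψ s) * this

lemma aux_memLp (q : ℝ) (hq : 0 < q) (ψ : ℝ → ℝ) (hψc : Continuous ψ)
    (hψs : HasCompactSupport ψ) :
    MemLp (fun s => ∫ y in Set.Ioi s, ψ y * Real.exp (q * (s - y))) 2 volume := by
  have hc : Continuous (fun s => ∫ y in Set.Ioi s, ψ y * Real.exp (q * (s - y))) :=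
    continuous_iff_continuousAt.2 fun s => (aux_deriv q ψ hψc hψs s).continuousAt
  obtain ⟨R, hR⟩ := hψs.isBounded.subset_closedBall 0
  have h0 : ∀ y, R < |y| → ψ y = 0 := by
    intro y hy
    apply image_eq_zero_of_notMem_tsupport
    intro h
    have := hR h
    simp at this
    linarith
  rw [memLp_two_iff_integrable_sq hc.aestronglyMeasurable]
  set P := (fun s => ∫ y in Set.Ioi s, ψ y * Real.exp (q * (s - y))) with hP
  have hr : ∀ s, R ≤ s → P s = 0 := by
    intro s hs
    apply setIntegral_eq_zero_of_forall_eq_zero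
    intro y hy
    rw [h0 y, zero_mul]
    exact lt_of_le_of_lt hs (lt_of_lt_of_le hy (le_abs_self y))
  have hl : ∀ s, s ≤ -R → P s = Real.exp (q * s) * ∫ y, ψ y * Real.exp (-(q * y)) := by
    intro s hs
    rw [hP]; simp only
    rw [setIntegral_eq_integral_of_ae_compl_eq_zero, ← integral_const_mul]
    · congr 1; ext y
      rw [mul_sub, sub_eq_add_neg, Real.exp_add]; ring
    · have : ∀ᵐ y : ℝ, y ≠ s := by simp [ae_iff]
      filter_upwards [this] with y hys hy
      rw [h0 y, zero_mul]
      have : y < s := lt_of_le_of_ne (by simpa using hy) hys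
      have := neg_le_abs y
      linarith
  have i1 : IntegrableOn (fun s => P s ^ 2) (Set.Iic (-R)) := by
    have : IntegrableOn (fun s => Real.exp ((2*q) * s) * (∫ y, ψ y * Real.exp (-(q * y)))^2)
        (Set.Iic (-R)) := by
      exact (integrableOn_exp_mul_Iic (by positivity) _).mul_const _
    refine this.congr_fun ?_ measurableSet_Iic
    intro s hs
    simp only
    rw [hl s hs, mul_pow, ← Real.exp_nat_mul]
    congr 2; push_cast; ring
  have i2 : IntegrableOn (fun s => P s ^ 2) (Set.Icc (-R) R) :=
    Continuous.integrableOn_Icc (by fun_prop)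
  have i3 : IntegrableOn (fun s => P s ^ 2) (Set.Ici R) := by
    refine (integrableOn_zero (ε' := ℝ)).congr_fun ?_ measurableSet_Ici
    intro s hs
    simp [hr s hs]
  rw [← integrableOn_univ]
  refine ((i1.union i2).union i3).mono_set ?_
  intro s _
  simp only [Set.mem_union, Set.mem_Iic, Set.mem_Icc, Set.mem_Ici]
  rcases le_total s (-R) with h | h <;> rcases le_total s R with h' | h' <;> tauto

lemma aux_ibp (q : ℝ) (ψ P : ℝ → ℝ) (hψc : Continuous ψ)
    (hP : ∀ s, HasDerivAt P (q * P s - ψ s) s) (f : ℝ → ℝ) (hf : ContDiff ℝ (⊤ : ℕ∞) f)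
    (hfs : HasCompactSupport f) :
    ∫ y, ψ y * f y = ∫ y, P y * (deriv f y + q * f y) := by
  have hPc : Continuous P := continuous_iff_continuousAt.2 fun s => (hP s).continuousAt
  have hfc := hf.continuous
  have hdc : Continuous (deriv f) := hf.continuous_deriv (by simp)
  have hds := hfs.deriv
  have hd : ∀ s, HasDerivAt (fun s => P s * f s) ((q * P s - ψ s) * f s + P s * deriv f s) s :=
    fun s => (hP s).mul (hf.differentiable (by simp) s).hasDerivAt
  have h0 := integral_eq_zero_of_hasDerivAt_of_integrable hd
    (Continuous.integrable_of_hasCompactSupport (by fun_prop) (hfs.mul_left.add hds.mul_left))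
    (Continuous.integrable_of_hasCompactSupport (by fun_prop) hfs.mul_left)
  have i1 : Integrable (fun y => P y * (deriv f y + q * f y)) :=
    Continuous.integrable_of_hasCompactSupport (by fun_prop)
      (HasCompactSupport.mul_left (hds.add hfs.mul_left))
  have i2 : Integrable (fun y => ψ y * f y) :=
    Continuous.integrable_of_hasCompactSupport (by fun_prop) hfs.mul_left
  rw [eq_comm, ← sub_eq_zero, ← integral_sub i1 i2, ← h0]
  congr 1; ext y; ring

lemma aux_energy (q : ℝ) (f : ℝ → ℝ) (hf : ContDiff ℝ (⊤ : ℕ∞) f)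
    (hfs : HasCompactSupport f) :
    ∫ y, ((deriv f y) ^ 2 + q ^ 2 * (f y) ^ 2) = ∫ y, (deriv f y + q * f y) ^ 2 := by
  have hfc := hf.continuous
  have hdc : Continuous (deriv f) := hf.continuous_deriv (by simp)
  have hds := hfs.deriv
  have hd : ∀ s, HasDerivAt (fun s => f s * f s) (deriv f s * f s + f s * deriv f s) s :=
    fun s => (hf.differentiable (by simp) s).hasDerivAt.mul
      (hf.differentiable (by simp) s).hasDerivAt
  have h0 := integral_eq_zero_of_hasDerivAt_of_integrable hd
    (Continuous.integrable_of_hasCompactSupport (by fun_prop) (hfs.mul_left.add hds.mul_left))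
    (Continuous.integrable_of_hasCompactSupport (by fun_prop) hfs.mul_left)
  have i1 : Integrable (fun y => (deriv f y + q * f y) ^ 2) := by
    simp only [pow_two]
    exact Continuous.integrable_of_hasCompactSupport (by fun_prop)
      (HasCompactSupport.mul_left (hds.add hfs.mul_left))
  have i2 : Integrable (fun y => (deriv f y) ^ 2 + q ^ 2 * (f y) ^ 2) := by
    simp only [pow_two]
    exact Continuous.integrable_of_hasCompactSupport (by fun_prop)
      (HasCompactSupport.add hds.mul_left hfs.mul_left.mul_left)
  rw [eq_comm, ← sub_eq_zero, ← integral_sub i1 i2, ← mul_zero q, ← h0, ← integral_const_mul]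
  congr 1; ext y; ring

lemma aux_solve (q : ℝ) (u : ℝ → ℝ) (hu : ContDiff ℝ (⊤ : ℕ∞) u)
    (hus : HasCompactSupport u) (h0 : ∫ s, Real.exp (q * s) * u s = 0) :
    ∃ f : ℝ → ℝ, ContDiff ℝ (⊤ : ℕ∞) f ∧ HasCompactSupport f ∧
      ∀ y, deriv f y + q * f y = u y := by
  have huc := hu.continuous
  obtain ⟨R, hR⟩ := hus.isBounded.subset_closedBall 0
  have hz : ∀ y, R < |y| → u y = 0 := by
    intro y hy
    apply image_eq_zero_of_notMem_tsupport
    intro h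
    have := hR h
    simp at this
    linarith
  have hInt : Integrable (fun s => Real.exp (q * s) * u s) :=
    Continuous.integrable_of_hasCompactSupport (by fun_prop) hus.mul_left
  have hF : ∀ y, HasDerivAt (fun y => ∫ s in Set.Iic y, Real.exp (q * s) * u s)
      (Real.exp (q * y) * u y) y := by
    intro y
    have h1 : (fun y => ∫ s in Set.Iic y, Real.exp (q * s) * u s) =
        fun y => (∫ s in Set.Iic 0, Real.exp (q * s) * u s)
          + ∫ s in (0:ℝ)..y, Real.exp (q * s) * u s := by
      ext y
      rw [← intervalIntegral.integral_Iic_sub_Iic hInt.integrableOn hInt.integrableOn]; ring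
    rw [h1]
    exact ((intervalIntegral.integral_hasDerivAt_right (hInt.intervalIntegrable)
        (Continuous.stronglyMeasurableAtFilter (by fun_prop) _ _) (by fun_prop))).const_add _
  set F := (fun y => ∫ s in Set.Iic y, Real.exp (q * s) * u s) with hFdef
  have hFs : ContDiff ℝ (⊤ : ℕ∞) F := by
    rw [contDiff_infty_iff_deriv]
    refine ⟨fun y => (hF y).differentiableAt, ?_⟩
    rw [show deriv F = fun y => Real.exp (q * y) * u y from funext fun y => (hF y).deriv]
    fun_prop
  have hF0 : ∀ y, R < |y| → F y = 0 := by
    intro y hy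
    rcases le_total 0 y with h | h
    · rw [abs_of_nonneg h] at hy
      rw [← h0, hFdef]
      apply setIntegral_eq_integral_of_forall_compl_eq_zero
      intro s hs
      rw [hz s, mul_zero]
      have : y < s := by simpa using hs
      have := le_abs_self s
      linarith
    · rw [abs_of_nonpos h] at hy
      apply setIntegral_eq_zero_of_forall_eq_zero
      intro s hs
      rw [hz s, mul_zero]
      have : s ≤ y := by simpa using hs
      have := neg_le_abs s
      linarith
  refine ⟨fun y => Real.exp (-(q * y)) * F y, by fun_prop, ?_, ?_⟩
  · apply HasCompactSupport.mul_left
    refine HasCompactSupport.intro (isCompact_closedBall (0:ℝ) R) fun x hx => hF0 x ?_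
    simpa using hx
  · intro y
    have he : HasDerivAt (fun s => Real.exp (-(q * s))) (Real.exp (-(q * y)) * (-q)) y := by
      simpa using ((hasDerivAt_id y).const_mul q).neg.exp
    rw [show deriv (fun y => Real.exp (-(q * y)) * F y) y = _ from (he.mul (hF y)).deriv]
    have : Real.exp (q * y) * Real.exp (-(q * y)) = 1 := by rw [← Real.exp_add]; simp
    linear_combination (u y) * this

lemma aux_inner (a b : Lp ℝ 2 (volume : Measure ℝ)) (u v : ℝ → ℝ) (ha : a =ᵐ[volume] u)
    (hb : b =ᵐ[volume] v) : inner ℝ a b = ∫ x, u x * v x := by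
  rw [L2.inner_def]
  apply integral_congr_ae
  filter_upwards [ha, hb] with x h1 h2
  simp [h1, h2, mul_comm]

lemma aux_norm (a : Lp ℝ 2 (volume : Measure ℝ)) (u : ℝ → ℝ) (ha : a =ᵐ[volume] u) :
    ‖a‖ ^ 2 = ∫ x, u x ^ 2 := by
  rw [← real_inner_self_eq_norm_sq, aux_inner a a u u ha ha]
  simp only [pow_two]

lemma aux_dense (q : ℝ) (hq : 0 < q) :
    Dense {a : Lp ℝ 2 (volume : Measure ℝ) | ∃ u : ℝ → ℝ, a =ᵐ[volume] u ∧ HasCompactSupport u ∧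
      ContDiff ℝ (⊤ : ℕ∞) u ∧ ∫ s, Real.exp (q * s) * u s = 0} := by
  have hd := Lp.dense_hasCompactSupport_contDiff (E := ℝ) (F := ℝ) (μ := volume) (p := 2) (by simp)
  rw [← dense_closure]
  refine hd.mono ?_
  rintro a ⟨u, hau, hus, hu⟩
  have huc := hu.continuous
  let η : ContDiffBump (0:ℝ) := default
  have hηc : Continuous η := η.continuous
  have hηs : HasCompactSupport η := η.hasCompactSupport
  have hdpos : 0 < ∫ s, Real.exp (q * s) * η s := by
    have hc : Continuous (fun s => Real.exp (q * s) * η s) := by fun_prop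
    refine hc.integral_pos_of_hasCompactSupport_nonneg_nonzero (x := 0) hηs.mul_left ?_ ?_
    · intro s
      have := η.nonneg (x := s)
      show 0 ≤ _
      positivity
    · have := η.pos_of_mem_ball (x := (0:ℝ)) (by simp [η.rOut_pos])
      simpa using this.ne'
  set d := ∫ s, Real.exp (q * s) * η s with hd_def
  set c := ∫ s, Real.exp (q * s) * u s with hc_def
  have hηm : ∀ n : ℕ, HasCompactSupport (fun s : ℝ => η (s - n)) := fun n => by
    simpa [Function.comp_def, sub_eq_add_neg] using hηs.comp_homeomorph (Homeomorph.addRight (-(n:ℝ)))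
  have hηl : ∀ n : ℕ, MemLp (fun s : ℝ => η (s - n)) 2 volume := fun n =>
    Continuous.memLp_of_hasCompactSupport (by fun_prop) (hηm n)
  have hn : ∀ n : ℕ, ‖(hηl n).toLp‖ = √(∫ x, η x ^ 2) := by
    intro n
    rw [← Real.sqrt_sq (norm_nonneg _), aux_norm _ _ (hηl n).coeFn_toLp,
      integral_sub_right_eq_self (fun x => η x ^ 2) (n:ℝ)]
  let r : ℕ → ℝ := fun n => c / (d * Real.exp (q * n))
  have hr : Filter.Tendsto r Filter.atTop (nhds 0) := by
    apply Filter.Tendsto.const_div_atTop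
    apply Filter.Tendsto.const_mul_atTop hdpos
    exact Real.tendsto_exp_atTop.comp (tendsto_natCast_atTop_atTop.const_mul_atTop hq)
  refine mem_closure_of_tendsto (f := fun n : ℕ => a - r n • (hηl n).toLp) (b := Filter.atTop) ?_ ?_
  · have : Filter.Tendsto (fun n : ℕ => r n • (hηl n).toLp) Filter.atTop (nhds 0) := by
      rw [tendsto_zero_iff_norm_tendsto_zero]
      simp only [norm_smul, hn]
      simpa using hr.norm.mul_const _
    simpa using tendsto_const_nhds.sub this
  · refine Filter.Eventually.of_forall fun n => ?_
    refine ⟨fun s => u s - r n * η (s - n), ?_, ?_, ?_, ?_⟩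
    · filter_upwards [hau, Lp.coeFn_sub a (r n • (hηl n).toLp),
        Lp.coeFn_smul (r n) (hηl n).toLp, (hηl n).coeFn_toLp] with x h1 h2 h3 h4
      rw [h2, Pi.sub_apply, h3, Pi.smul_apply, h4, h1, smul_eq_mul]
    · exact hus.sub (hηm n).mul_left
    · have : ContDiff ℝ (⊤ : ℕ∞) (fun s : ℝ => η (s - n)) :=
        η.contDiff.comp (contDiff_id.sub contDiff_const)
      exact hu.sub (contDiff_const.mul this)
    · have i1 : Integrable (fun s => Real.exp (q * s) * u s) :=
        Continuous.integrable_of_hasCompactSupport (by fun_prop) hus.mul_left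
      have i2 : Integrable (fun s => r n * (Real.exp (q * s) * η (s - n))) :=
        Continuous.integrable_of_hasCompactSupport (by fun_prop) (hηm n).mul_left.mul_left
      have e : ∫ s, Real.exp (q * s) * η (s - n) = Real.exp (q * n) * d := by
        rw [← integral_add_right_eq_self _ (n:ℝ), hd_def, ← integral_const_mul]
        congr 1; ext s
        rw [add_sub_cancel_right, mul_add, Real.exp_add]; ring
      calc _ = ∫ s, (Real.exp (q * s) * u s - r n * (Real.exp (q * s) * η (s - n))) := by
            congr 1; ext s; ring
        _ = c - r n * (Real.exp (q * n) * d) := by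
            rw [integral_sub i1 i2, integral_const_mul, e]
        _ = 0 := by
            simp only [r]
            have := Real.exp_pos (q * n)
            field_simp
            ring

theorem stmt12 (q : ℝ) (hq : 0 < q) (ψ : ℝ → ℝ) (hψc : Continuous ψ)
    (hψs : HasCompactSupport ψ) :
    IsLUB {v : ℝ | ∃ f : ℝ → ℝ, ContDiff ℝ (⊤ : ℕ∞) f ∧ HasCompactSupport f ∧
        (∫ y : ℝ, ((deriv f y) ^ 2 + q ^ 2 * (f y) ^ 2)) ≤ 1 ∧
        v = ∫ y : ℝ, ψ y * f y}
      (Real.sqrt (∫ s : ℝ, (∫ y in Set.Ioi s, ψ y * Real.exp (q * (s - y))) ^ 2)) := by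
  have hP := aux_deriv q ψ hψc hψs
  have hL := aux_memLp q hq ψ hψc hψs
  set P := (fun s => ∫ y in Set.Ioi s, ψ y * Real.exp (q * (s - y))) with hPdef
  have hG := hL.coeFn_toLp
  set G := hL.toLp with hGdef
  have hN : Real.sqrt (∫ s : ℝ, (∫ y in Set.Ioi s, ψ y * Real.exp (q * (s - y))) ^ 2) = ‖G‖ := by
    rw [← Real.sqrt_sq (norm_nonneg G), aux_norm G P hG]
  rw [hN]
  constructor
  · rintro v ⟨f, hf, hfs, hE, rfl⟩
    have hdc : Continuous (deriv f) := hf.continuous_deriv (by simp)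
    have hfc := hf.continuous
    have hu : MemLp (fun y => deriv f y + q * f y) 2 volume :=
      Continuous.memLp_of_hasCompactSupport (by fun_prop) (hfs.deriv.add hfs.mul_left)
    rw [aux_energy q f hf hfs, ← aux_norm hu.toLp _ hu.coeFn_toLp] at hE
    rw [aux_ibp q ψ P hψc hP f hf hfs, ← aux_inner G hu.toLp _ _ hG hu.coeFn_toLp]
    have h1 : ‖hu.toLp‖ ≤ 1 := by
      have := norm_nonneg hu.toLp
      nlinarith
    calc _ ≤ ‖G‖ * ‖hu.toLp‖ := real_inner_le_norm _ _
      _ ≤ ‖G‖ * 1 := by gcongr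
      _ = ‖G‖ := mul_one _
  · intro b hb
    have hb0 : 0 ≤ b := hb ⟨fun _ => 0, contDiff_const, HasCompactSupport.zero, by simp, by simp⟩
    have key : ∀ v : Lp ℝ 2 (volume : Measure ℝ), inner ℝ G v ≤ b * ‖v‖ := by
      intro v
      refine (aux_dense q hq).induction (P := fun v => inner ℝ G v ≤ b * ‖v‖) ?_ ?_ v
      · rintro v ⟨u, hvu, hus, hu, h0⟩
        rcases eq_or_ne v 0 with rfl | hv
        · simp
        have ht : 0 < ‖v‖ := norm_pos_iff.2 hv
        obtain ⟨f, hf, hfs, hfu⟩ := aux_solve q u hu hus h0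
        have hv2 := aux_norm v u hvu
        have hvi := aux_inner G v P u hG hvu
        simp only [← hfu] at hv2 hvi
        rw [← aux_energy q f hf hfs] at hv2
        rw [← aux_ibp q ψ P hψc hP f hf hfs] at hvi
        have := hb ⟨fun y => ‖v‖⁻¹ * f y, by fun_prop, hfs.mul_left, ?_, rfl⟩
        · rw [show (fun y => ψ y * (‖v‖⁻¹ * f y)) = fun y => ‖v‖⁻¹ * (ψ y * f y) by
            ext y; ring, integral_const_mul, ← hvi] at this
          rwa [inv_mul_le_iff₀ ht, mul_comm] at this
        · have e : ∀ y, deriv (fun y => ‖v‖⁻¹ * f y) y = ‖v‖⁻¹ * deriv f y := fun y =>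
            deriv_const_mul_field _
          simp only [e]
          rw [show (fun y => (‖v‖⁻¹ * deriv f y) ^ 2 + q ^ 2 * (‖v‖⁻¹ * f y) ^ 2) =
            fun y => (‖v‖⁻¹) ^ 2 * ((deriv f y) ^ 2 + q ^ 2 * (f y) ^ 2) by ext y; ring,
            integral_const_mul, ← hv2, ← mul_pow, inv_mul_cancel₀ ht.ne', one_pow]
      · exact isClosed_le (by fun_prop) (by fun_prop)
    have := key G
    rw [real_inner_self_eq_norm_sq] at this
    by_contra! h
    nlinarith
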